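/- arXiv:math/0507550 — 9 statements merged into one kernel-verified Lean document; each statement's English description precedes it below -/
import Mathlib

section
/- Let A be a 7-tuple and let e₁ and e₂ be bar-units of A. Then for every α ∈ A, e₁ ⇀ α = 0 if and only if e₂ ⇀ α = 0. Consequently the additive halo ℏ⁺(A) = {α ∈ A | e ⇀ α = 0} does not depend on the choice of the bar-unit e. -/
/-- A 7-tuple: an abelian group with three binary operations `sharp` (♯),
`lp` (left product ⇀) and `rp` (right product ↼), each associative and
bi-distributive over `+`, satisfying the Hu-Liu triassociative law. -/
structure SevenTuple (A : Type*) [AddCommGroup A] where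
  sharp : A → A → A
  lp : A → A → A
  rp : A → A → A
  sharp_assoc : ∀ x y z : A, sharp (sharp x y) z = sharp x (sharp y z)
  lp_assoc : ∀ x y z : A, lp (lp x y) z = lp x (lp y z)
  rp_assoc : ∀ x y z : A, rp (rp x y) z = rp x (rp y z)
  sharp_add_left : ∀ x y z : A, sharp (x + y) z = sharp x z + sharp y z
  sharp_add_right : ∀ x y z : A, sharp x (y + z) = sharp x y + sharp x z
  lp_add_left : ∀ x y z : A, lp (x + y) z = lp x z + lp y z
  lp_add_right : ∀ x y z : A, lp x (y + z) = lp x y + lp x z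
  rp_add_left : ∀ x y z : A, rp (x + y) z = rp x z + rp y z
  rp_add_right : ∀ x y z : A, rp x (y + z) = rp x y + rp x z
  tri1 : ∀ x y z : A, sharp (lp x y) z = sharp x (rp y z)
  tri2 : ∀ x y z : A, lp (sharp x y) z = sharp x (lp y z)
  tri3 : ∀ x y z : A, rp x (sharp y z) = sharp (rp x y) z
  tri4 : ∀ x y z : A, lp x (sharp y z) = lp (lp x y) z
  tri5 : ∀ x y z : A, rp (sharp x y) z = rp (rp x y) z

variable {A : Type*} [AddCommGroup A]

/-- A bar-unit: `e ↼ x = x = x ⇀ e` for all `x`. -/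
def SevenTuple.IsBarUnit (T : SevenTuple A) (e : A) : Prop :=
  ∀ x : A, T.rp e x = x ∧ T.lp x e = x

/-- An identity: `x ♯ 1 = x = 1 ♯ x` and `x ⇀ 1 = x = 1 ↼ x` for all `x`. -/
def SevenTuple.IsIdentity (T : SevenTuple A) (one : A) : Prop :=
  ∀ x : A, T.sharp x one = x ∧ T.sharp one x = x ∧ T.lp x one = x ∧ T.rp one x = x

/-- The halo ℏ×(A): the set of bar-units. -/
def SevenTuple.halo (T : SevenTuple A) : Set A := {e | T.IsBarUnit e}

/-- The additive halo ℏ⁺(A) relative to a bar-unit `e`: `{α | e ⇀ α = 0}`. -/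
def SevenTuple.addHalo (T : SevenTuple A) (e : A) : Set A := {α | T.lp e α = 0}

/-- The Hu-Liu product induced by `e`: `x • y = x ↼ y + x ⇀ y − (x ↼ e) ⇀ y`. -/
def SevenTuple.bullet (T : SevenTuple A) (e x y : A) : A :=
  T.rp x y + T.lp x y - T.lp (T.rp x e) y

/-- The angle bracket `⟨x, y⟩ = x ⇀ y − y ↼ x`. -/
def SevenTuple.angle (T : SevenTuple A) (x y : A) : A := T.lp x y - T.rp y x

/-- The square bracket `[x, y] = x ♯ y − y ♯ x`. -/
def SevenTuple.sq (T : SevenTuple A) (x y : A) : A := T.sharp x y - T.sharp y x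

theorem SevenTuple.lp_zero (T : SevenTuple A) (x : A) : T.lp x 0 = 0 := by
  simpa using T.lp_add_right x 0 0

theorem SevenTuple.IsBarUnit.lp_lp {T : SevenTuple A} {e : A} (h : T.IsBarUnit e) (x y : A) :
    T.lp x (T.lp e y) = T.lp x y := by
  rw [← T.lp_assoc, (h x).2]

theorem SevenTuple.IsBarUnit.lp_eq_zero {T : SevenTuple A} {e : A} (h : T.IsBarUnit e) {y : A}
    (hy : T.lp e y = 0) (x : A) : T.lp x y = 0 := by
  rw [← h.lp_lp, hy, T.lp_zero]

/-- The additive halo ℏ⁺(A) does not depend on the choice of bar-unit: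
for bar-units `e₁, e₂` and any `α`, `e₁ ⇀ α = 0 ↔ e₂ ⇀ α = 0`. -/
theorem addHalo_independent (T : SevenTuple A) (e₁ e₂ : A)
    (h₁ : T.IsBarUnit e₁) (h₂ : T.IsBarUnit e₂) :
    ∀ α : A, T.lp e₁ α = 0 ↔ T.lp e₂ α = 0 :=
  fun _ => ⟨fun h => h₁.lp_eq_zero h e₂, fun h => h₂.lp_eq_zero h e₁⟩
end

section
/- Let A be a 7-tuple with an identity 1 and let e be a bar-unit of A. Then the additive halo ℏ⁺(A) = {α ∈ A | e ⇀ α = 0} is a rng under + and ♯; that is, ℏ⁺(A) is an additive subgroup of A (it contains 0 and is closed under subtraction) and it is closed under the product ♯. -/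
variable {A : Type*} [AddCommGroup A]

/-- The additive halo ℏ⁺(A) is a rng under `+` and ♯: it contains `0`,
is closed under subtraction, and is closed under ♯. -/
theorem addHalo_rng (T : SevenTuple A) (one : A) (hone : T.IsIdentity one)
    (e : A) (he : T.IsBarUnit e) :
    (0 : A) ∈ T.addHalo e ∧
    (∀ α β : A, α ∈ T.addHalo e → β ∈ T.addHalo e → α - β ∈ T.addHalo e) ∧
    (∀ α β : A, α ∈ T.addHalo e → β ∈ T.addHalo e → T.sharp α β ∈ T.addHalo e) := by
  have lp_zero (x : A) : T.lp x 0 = 0 := by simpa using T.lp_add_right x 0 0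
  have zero_lp (x : A) : T.lp 0 x = 0 := by simpa using T.lp_add_left 0 0 x
  refine ⟨lp_zero e, fun α β hα hβ => ?_, fun α β hα _ => ?_⟩
  · change T.lp e α = 0 at hα
    change T.lp e β = 0 at hβ
    have h := T.lp_add_right e (α - β) β
    rw [sub_add_cancel, hα, hβ, add_zero] at h
    exact h.symm
  · change T.lp e α = 0 at hα
    change T.lp e (T.sharp α β) = 0
    rw [T.tri4, hα, zero_lp]
end

section
/- Let A be a 7-tuple with an identity 1 and let e ∈ ℏ×(A) be a bar-unit. Define the Hu-Liu product induced by e by x •ₑ y := x ↼ y + x ⇀ y − (x ↼ e) ⇀ y. Then the halo ℏ×(A) is a monoid under •ₑ with unit e; in particular, e₁ •ₑ e₂ ∈ ℏ×(A) whenever e₁, e₂ ∈ ℏ×(A). -/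
variable {A : Type*} [AddCommGroup A]

namespace SevenTuple

theorem rp_sub_left (T : SevenTuple A) (x y z : A) :
    T.rp (x - y) z = T.rp x z - T.rp y z :=
  map_sub (AddMonoidHom.mk' (fun w => T.rp w z) fun a b => T.rp_add_left a b z) x y

theorem lp_sub_right (T : SevenTuple A) (x y z : A) :
    T.lp x (y - z) = T.lp x y - T.lp x z :=
  map_sub (AddMonoidHom.mk' (T.lp x) (T.lp_add_right x)) y z

/-- On the halo, the Hu-Liu product induced by `e` is addition translated by `e`. -/
theorem bullet_eq_of_mem_halo (T : SevenTuple A) {e x y : A}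
    (hx : x ∈ T.halo) (hy : y ∈ T.halo) : T.bullet e x y = y + x - e := by
  rw [bullet, (hx y).1, (hy x).2, (hx e).1, (hy e).2]

theorem bullet_mem_halo (T : SevenTuple A) {e x y : A}
    (he : e ∈ T.halo) (hx : x ∈ T.halo) (hy : y ∈ T.halo) : T.bullet e x y ∈ T.halo := by
  intro z
  rw [T.bullet_eq_of_mem_halo hx hy]
  constructor
  · rw [rp_sub_left, rp_add_left, (hx z).1, (hy z).1, (he z).1, add_sub_cancel_right]
  · rw [lp_sub_right, lp_add_right, (hx z).2, (hy z).2, (he z).2, add_sub_cancel_right]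

end SevenTuple

/-- For a bar-unit `e`, the halo ℏ×(A) is a monoid under the Hu-Liu product
`•ₑ` with unit `e`: it is closed under `•ₑ`, `e` is a two-sided `•ₑ`-unit on
the halo, and `•ₑ` is associative on the halo. -/
theorem halo_monoid_bullet (T : SevenTuple A) (one : A) (hone : T.IsIdentity one)
    (e : A) (he : e ∈ T.halo) :
    (∀ e₁ e₂ : A, e₁ ∈ T.halo → e₂ ∈ T.halo → T.bullet e e₁ e₂ ∈ T.halo) ∧
    (∀ x ∈ T.halo, T.bullet e x e = x ∧ T.bullet e e x = x) ∧
    (∀ x y z : A, x ∈ T.halo → y ∈ T.halo → z ∈ T.halo →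
      T.bullet e (T.bullet e x y) z = T.bullet e x (T.bullet e y z)) := by
  refine ⟨fun x y hx hy => T.bullet_mem_halo he hx hy, fun x hx => ⟨?_, ?_⟩,
    fun x y z hx hy hz => ?_⟩
  · rw [T.bullet_eq_of_mem_halo hx he, add_sub_cancel_left]
  · rw [T.bullet_eq_of_mem_halo he hx, add_sub_cancel_right]
  · rw [T.bullet_eq_of_mem_halo (T.bullet_mem_halo he hx hy) hz,
      T.bullet_eq_of_mem_halo hx (T.bullet_mem_halo he hy hz),
      T.bullet_eq_of_mem_halo hx hy, T.bullet_eq_of_mem_halo hy hz]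
    abel
end

section
/- Let A be a 7-tuple with an identity 1, and let a ∈ A be one-sided invertible. Suppose y₁ ⇀ a = e₁ = a ↼ z₁ and y₂ ⇀ a = e₂ = a ↼ z₂, where e₁ and e₂ are bar-units of A. Then for every x ∈ A: (y₁ ↼ x) ⇀ a = (z₁ ↼ x) ⇀ a = (y₂ ↼ x) ⇀ a = (z₂ ↼ x) ⇀ a. In other words, the diconjugation Ψ_a(x) := (a^{ℓ-1} ↼ x) ⇀ a is independent of whether the left or the right inverse of a is used and of the choice of bar-unit. -/
variable {A : Type*} [AddCommGroup A]

namespace SevenTuple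

variable {T : SevenTuple A} {one : A}

theorem IsIdentity.lp_eq (h : T.IsIdentity one) (x y : A) :
    T.lp x y = T.sharp x (T.lp one y) := by
  rw [← T.tri2, (h x).1]

theorem IsIdentity.rp_one (h : T.IsIdentity one) (x : A) : T.rp x one = T.lp one x := by
  have := T.tri1 one x one
  rwa [(h _).1, (h _).2.1, eq_comm] at this

theorem IsIdentity.rp_eq (h : T.IsIdentity one) (x y : A) :
    T.rp x y = T.sharp (T.lp one x) y := by
  rw [← h.rp_one, ← T.tri3, (h y).2.1]

theorem IsIdentity.lp_one_sharp (h : T.IsIdentity one) (x y : A) :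
    T.lp one (T.sharp x y) = T.sharp (T.lp one x) (T.lp one y) := by
  rw [T.tri4, h.lp_eq (T.lp one x)]

theorem IsIdentity.lp_one_idem (h : T.IsIdentity one) (x : A) :
    T.lp one (T.lp one x) = T.lp one x := by
  rw [← T.lp_assoc, (h one).2.2.1]

/-- The projection `1 ⇀ ·` sends a left inverse of `a` to a left `♯`-inverse of `1 ⇀ a`. -/
theorem IsIdentity.sharp_lp_one_of_lp (h : T.IsIdentity one) {y a e : A}
    (he : T.IsBarUnit e) (hy : T.lp y a = e) :
    T.sharp (T.lp one y) (T.lp one a) = one := by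
  rw [← h.lp_eq, T.lp_assoc, hy, (he one).2]

/-- The projection `1 ⇀ ·` sends a right inverse of `a` to a right `♯`-inverse of `1 ⇀ a`. -/
theorem IsIdentity.sharp_lp_one_of_rp (h : T.IsIdentity one) {z a e : A}
    (he : T.IsBarUnit e) (hz : T.rp a z = e) :
    T.sharp (T.lp one a) (T.lp one z) = one := by
  have := (he one).2
  rwa [← hz, h.rp_eq, h.lp_one_sharp, h.lp_one_idem] at this

/-- Left and right inverses of `a`, with respect to any bar-units, act equally under `↼`. -/
theorem IsIdentity.rp_left_inverse_eq (h : T.IsIdentity one) {a y z e f : A}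
    (he : T.IsBarUnit e) (hf : T.IsBarUnit f) (hy : T.lp y a = e) (hz : T.rp a z = f) (x : A) :
    T.rp y x = T.rp z x := by
  have key : T.lp one y = T.lp one z := by
    have := T.sharp_assoc (T.lp one y) (T.lp one a) (T.lp one z)
    rwa [h.sharp_lp_one_of_lp he hy, h.sharp_lp_one_of_rp hf hz, (h _).2.1, (h _).1,
      eq_comm] at this
  rw [h.rp_eq, h.rp_eq, key]

end SevenTuple

/-- The diconjugation `Ψ_a(x) = (a⁻¹ ↼ x) ⇀ a` is independent of whether a
left or right inverse of `a` is used, and of the choice of bar-unit. -/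
theorem diconjugation_well_defined (T : SevenTuple A) (one : A)
    (hone : T.IsIdentity one) (a y₁ z₁ y₂ z₂ e₁ e₂ : A)
    (he₁ : T.IsBarUnit e₁) (he₂ : T.IsBarUnit e₂)
    (hy₁ : T.lp y₁ a = e₁) (hz₁ : T.rp a z₁ = e₁)
    (hy₂ : T.lp y₂ a = e₂) (hz₂ : T.rp a z₂ = e₂) :
    ∀ x : A,
      T.lp (T.rp y₁ x) a = T.lp (T.rp z₁ x) a ∧
      T.lp (T.rp z₁ x) a = T.lp (T.rp y₂ x) a ∧
      T.lp (T.rp y₂ x) a = T.lp (T.rp z₂ x) a := by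
  intro x
  rw [hone.rp_left_inverse_eq he₁ he₁ hy₁ hz₁, hone.rp_left_inverse_eq he₂ he₁ hy₂ hz₁,
    ← hone.rp_left_inverse_eq he₂ he₂ hy₂ hz₂, hone.rp_left_inverse_eq he₂ he₁ hy₂ hz₁]
  exact ⟨rfl, rfl, rfl⟩
end

section
/- Let A be a 7-tuple with an identity 1, let e₁ be a bar-unit of A, and suppose a ∈ A satisfies y ⇀ a = e₁ = a ↼ z for some y, z ∈ A. Then for every bar-unit e₂ of A there exist y′, z′ ∈ A with y′ ⇀ a = e₂ = a ↼ z′. In other words, the set A^{-̌1} of one-sided invertible elements does not depend on the choice of the bar-unit used in its definition. -/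
variable {A : Type*} [AddCommGroup A]

/-- The set of one-sided invertible elements does not depend on the choice of
bar-unit: if `y ⇀ a = e₁ = a ↼ z` for a bar-unit `e₁`, then for any bar-unit
`e₂` there are `y', z'` with `y' ⇀ a = e₂ = a ↼ z'`. -/
theorem oneSided_invertible_independent (T : SevenTuple A) (one : A)
    (hone : T.IsIdentity one) (a y z e₁ : A) (he₁ : T.IsBarUnit e₁)
    (hy : T.lp y a = e₁) (hz : T.rp a z = e₁) :
    ∀ e₂ : A, T.IsBarUnit e₂ → ∃ y' z' : A, T.lp y' a = e₂ ∧ T.rp a z' = e₂ := by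
  intro e₂ _
  refine ⟨T.lp e₂ y, T.rp z e₂, ?_, ?_⟩
  · rw [T.lp_assoc, hy, (he₁ e₂).2]
  · rw [← T.rp_assoc, hz, (he₁ e₂).1]
end

section
/- Let A be a 7-tuple with an identity 1, and let a ∈ A be one-sided invertible, say y ⇀ a = e₀ = a ↼ z for some y, z ∈ A and bar-unit e₀. Define the diconjugation Ψ_a : A → A by Ψ_a(x) = (y ↼ x) ⇀ a. Then Ψ_a maps the halo ℏ×(A) onto ℏ×(A) and maps the additive halo ℏ⁺(A) onto ℏ⁺(A): Ψ_a(ℏ×(A)) = ℏ×(A) and Ψ_a(ℏ⁺(A)) = ℏ⁺(A). -/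
variable {A : Type*} [AddCommGroup A]

namespace SevenTuple

variable {T : SevenTuple A} {one : A}

theorem sharp_zero (T : SevenTuple A) (x : A) : T.sharp x 0 = 0 := by
  simpa using T.sharp_add_right x 0 0

theorem zero_sharp (T : SevenTuple A) (x : A) : T.sharp 0 x = 0 := by
  simpa using T.sharp_add_left 0 0 x

theorem lp_zero_s9 (T : SevenTuple A) (x : A) : T.lp x 0 = 0 := by
  simpa using T.lp_add_right x 0 0

namespace IsIdentity

theorem lp_eq_sharp (h : T.IsIdentity one) (x z : A) :
    T.lp x z = T.sharp x (T.lp one z) := by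
  rw [← T.tri2, (h x).1]

/-- With an identity, both one-sided products are determined by `♯` and the single
endomorphism `x ↦ 1 ⇀ x = x ↼ 1`. -/
theorem rp_eq_sharp (h : T.IsIdentity one) (x z : A) :
    T.rp x z = T.sharp (T.lp one x) z := by
  rw [T.tri1, (h _).2.1]

theorem lp_one_sharp_s9 (h : T.IsIdentity one) (x y : A) :
    T.lp one (T.sharp x y) = T.sharp (T.lp one x) (T.lp one y) := by
  rw [T.tri4, h.lp_eq_sharp]

theorem lp_one_lp_one (h : T.IsIdentity one) (x : A) :
    T.lp one (T.lp one x) = T.lp one x := by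
  rw [← T.lp_assoc, (h one).2.2.1]

theorem mem_halo_iff (h : T.IsIdentity one) {e : A} :
    e ∈ T.halo ↔ T.lp one e = one := by
  refine ⟨fun he => (he one).2, fun he x => ⟨?_, ?_⟩⟩
  · rw [h.rp_eq_sharp, he, (h x).2.1]
  · rw [h.lp_eq_sharp, he, (h x).1]

theorem mem_addHalo_iff (h : T.IsIdentity one) {e α : A} (he : T.IsBarUnit e) :
    α ∈ T.addHalo e ↔ T.lp one α = 0 := by
  constructor
  · intro hα
    have hα' : T.lp e α = 0 := hα
    have key := T.lp_assoc one e α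
    rwa [(he one).2, hα', T.lp_zero_s9] at key
  · intro hα
    change T.lp e α = 0
    rw [h.lp_eq_sharp, hα, T.sharp_zero]

/-- Diconjugation permutes any fibre of `x ↦ 1 ⇀ x` over an element `c` fixed by
conjugation in both directions. -/
theorem image_diconjugation_fibre (h : T.IsIdentity one) {a y c : A}
    (hya : T.sharp (T.lp one y) (T.lp one a) = one)
    (hc : T.sharp (T.sharp (T.lp one y) c) (T.lp one a) = c)
    (hc' : T.sharp (T.sharp (T.lp one a) c) (T.lp one y) = c) :
    (fun x => T.lp (T.rp y x) a) '' {x | T.lp one x = c} = {x | T.lp one x = c} := by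
  have hΨ (x : A) :
      T.lp (T.rp y x) a = T.sharp (T.sharp (T.lp one y) x) (T.lp one a) := by
    rw [h.lp_eq_sharp, h.rp_eq_sharp]
  ext w
  constructor
  · rintro ⟨x, hx : T.lp one x = c, rfl⟩
    change T.lp one (T.lp (T.rp y x) a) = c
    rw [hΨ, h.lp_one_sharp_s9, h.lp_one_sharp_s9, h.lp_one_lp_one, h.lp_one_lp_one, hx, hc]
  · intro (hw : T.lp one w = c)
    refine ⟨T.sharp (T.sharp (T.lp one a) w) (T.lp one y), ?_, ?_⟩
    · change T.lp one _ = c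
      rw [h.lp_one_sharp_s9, h.lp_one_sharp_s9, h.lp_one_lp_one, h.lp_one_lp_one, hw, hc']
    · change T.lp (T.rp y _) a = w
      rw [hΨ, T.sharp_assoc, T.sharp_assoc, hya, (h _).1, ← T.sharp_assoc, hya, (h w).2.1]

end IsIdentity

end SevenTuple

/-- The diconjugation `Ψ_a` maps the halo onto the halo and the additive halo
onto the additive halo. -/
theorem diconjugation_preserves_halos (T : SevenTuple A) (one : A)
    (hone : T.IsIdentity one) (a y z e₀ : A) (he₀ : T.IsBarUnit e₀)
    (hy : T.lp y a = e₀) (hz : T.rp a z = e₀) :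
    (fun x => T.lp (T.rp y x) a) '' T.halo = T.halo ∧
    (fun x => T.lp (T.rp y x) a) '' T.addHalo e₀ = T.addHalo e₀ := by
  have hd : T.lp one e₀ = one := (he₀ one).2
  have hya : T.sharp (T.lp one y) (T.lp one a) = one := by
    rw [← hone.lp_eq_sharp, T.lp_assoc, hy, hd]
  have haz : T.sharp (T.lp one a) (T.lp one z) = one := by
    rwa [← hz, hone.rp_eq_sharp, hone.lp_one_sharp_s9, hone.lp_one_lp_one] at hd
  have hzy : T.lp one z = T.lp one y := by
    rw [← (hone (T.lp one z)).2.1, ← hya, T.sharp_assoc, hya, haz, (hone _).1]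
  have hay : T.sharp (T.lp one a) (T.lp one y) = one := hzy ▸ haz
  have hhalo : T.halo = {x | T.lp one x = one} := Set.ext fun _ => hone.mem_halo_iff
  have haddHalo : T.addHalo e₀ = {x | T.lp one x = 0} :=
    Set.ext fun _ => hone.mem_addHalo_iff he₀
  rw [hhalo, haddHalo]
  constructor
  · apply hone.image_diconjugation_fibre hya
    · rw [(hone _).1, hya]
    · rw [(hone _).1, hay]
  · apply hone.image_diconjugation_fibre hya <;> rw [T.sharp_zero, T.zero_sharp]
end

section
/- Let A be a 7-tuple. Define the angle bracket ⟨x, y⟩ := x ⇀ y − y ↼ x and the square bracket [x, y] := x ♯ y − y ♯ x. Then for all x, y, z ∈ A: [x, ⟨y, z⟩] + [y, ⟨z, x⟩] + [z, ⟨x, y⟩] = [x, ⟨z, y⟩] + [z, ⟨y, x⟩] + [y, ⟨x, z⟩] + ⟨[x, y], z⟩ + ⟨[y, z], x⟩ + ⟨[z, x], y⟩. -/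
variable {A : Type*} [AddCommGroup A]

namespace SevenTuple

theorem sharp_sub_left (T : SevenTuple A) (x y z : A) :
    T.sharp (x - y) z = T.sharp x z - T.sharp y z := by
  rw [eq_sub_iff_add_eq, ← T.sharp_add_left, sub_add_cancel]

theorem sharp_sub_right (T : SevenTuple A) (x y z : A) :
    T.sharp x (y - z) = T.sharp x y - T.sharp x z := by
  rw [eq_sub_iff_add_eq, ← T.sharp_add_right, sub_add_cancel]

theorem lp_sub_left (T : SevenTuple A) (x y z : A) :
    T.lp (x - y) z = T.lp x z - T.lp y z := by
  rw [eq_sub_iff_add_eq, ← T.lp_add_left, sub_add_cancel]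

theorem rp_sub_right (T : SevenTuple A) (x y z : A) :
    T.rp x (y - z) = T.rp x y - T.rp x z := by
  rw [eq_sub_iff_add_eq, ← T.rp_add_right, sub_add_cancel]

end SevenTuple

/-- In a 7-tuple, the angle bracket `⟨x,y⟩ = x ⇀ y − y ↼ x` and the square
bracket `[x,y] = x ♯ y − y ♯ x` satisfy the identity (18). -/
theorem bracket_identity (T : SevenTuple A) :
    ∀ x y z : A,
      T.sq x (T.angle y z) + T.sq y (T.angle z x) + T.sq z (T.angle x y)
        = T.sq x (T.angle z y) + T.sq z (T.angle y x) + T.sq y (T.angle x z)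
          + T.angle (T.sq x y) z + T.angle (T.sq y z) x + T.angle (T.sq z x) y := by
  intro x y z
  simp only [SevenTuple.sq, SevenTuple.angle, T.sharp_sub_left, T.sharp_sub_right,
    T.lp_sub_left, T.rp_sub_right, T.tri1, T.tri2, T.tri3]
  abel
end

section
/- Let A be a 7-tuple with an identity 1 and a bar-unit e. Define the angle bracket ⟨x, y⟩ := x ⇀ y − y ↼ x and the square bracket [x, y] := x ♯ y − y ♯ x, and let ℏ⁺(A) = {α ∈ A | e ⇀ α = 0} be the additive halo. Then the Hu-Liu identity holds: ⟨[α, β], z⟩ + [⟨β, z⟩, α] + [β, ⟨α, z⟩] = 0 for all α, β ∈ ℏ⁺(A) and all z ∈ A. -/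
variable {A : Type*} [AddCommGroup A]

/-- The Hu-Liu identity: for `α, β` in the additive halo and any `z`,
`⟨[α,β],z⟩ + [⟨β,z⟩,α] + [β,⟨α,z⟩] = 0`. -/
theorem hu_liu_identity (T : SevenTuple A) (one : A) (hone : T.IsIdentity one)
    (e : A) (he : T.IsBarUnit e) :
    ∀ α β z : A, α ∈ T.addHalo e → β ∈ T.addHalo e →
      T.angle (T.sq α β) z + T.sq (T.angle β z) α + T.sq β (T.angle α z) = 0 := by
  intro α β z _ _
  simp only [SevenTuple.angle, SevenTuple.sq, T.sharp_sub_left, T.sharp_sub_right,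
    T.lp_sub_left, T.rp_sub_right, T.tri1, T.tri2, T.tri3]
  abel
end

section
/- Let A be a 7-tuple with an identity 1, let e be a bar-unit of A, and let ℏ⁺(A) = {α ∈ A | e ⇀ α = 0} be the additive halo. Define the angle bracket ⟨x, y⟩ := x ⇀ y − y ↼ x. Then ⟨A, ℏ⁺(A)⟩ = 0 and ⟨ℏ⁺(A), A⟩ ⊆ ℏ⁺(A); that is, for every x ∈ A and α ∈ ℏ⁺(A), ⟨x, α⟩ = 0 and ⟨α, x⟩ ∈ ℏ⁺(A). -/
variable {A : Type*} [AddCommGroup A]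

/-- `⟨A, ℏ⁺(A)⟩ = 0` and `⟨ℏ⁺(A), A⟩ ⊆ ℏ⁺(A)`. -/
theorem angle_addHalo (T : SevenTuple A) (one : A) (hone : T.IsIdentity one)
    (e : A) (he : T.IsBarUnit e) :
    ∀ x α : A, α ∈ T.addHalo e →
      T.angle x α = 0 ∧ T.angle α x ∈ T.addHalo e := by
  intro x α hα
  have hα' : T.lp e α = 0 := hα
  have zero_lp (y : A) : T.lp 0 y = 0 := by simpa using T.lp_add_left 0 0 y
  have lp_zero (y : A) : T.lp y 0 = 0 := by simpa using T.lp_add_right y 0 0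
  have zero_sharp (y : A) : T.sharp 0 y = 0 := by simpa using T.sharp_add_left 0 0 y
  have rp_eq (y z : A) : T.rp y z = T.sharp (T.lp one y) z := by
    rw [T.tri1, (hone _).2.1]
  have lp_halo (y : A) : T.lp y α = 0 := by
    rw [← (he y).2, T.lp_assoc, hα', lp_zero]
  refine ⟨?_, ?_⟩
  · rw [SevenTuple.angle, rp_eq, lp_halo, lp_halo, zero_sharp, sub_zero]
  · have h : T.lp e (T.angle α x) + T.lp e (T.rp x α) = T.lp e (T.lp α x) := by
      rw [← T.lp_add_right, SevenTuple.angle, sub_add_cancel]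
    rw [rp_eq, T.tri4, lp_halo, add_zero, ← T.lp_assoc, hα', zero_lp] at h
    exact h
end
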